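/- (Uniqueness of the optimal solution.) Suppose R₀ ≥ 0. If û and ũ are two admissible controls both minimizing J, then û(t) = ũ(t) for almost every t ∈ [0,T]; in particular the optimal state trajectory Kû = Kũ is unique. -/

import Mathlib

open MeasureTheory Real

/-- An admissible control: measurable, with values in `[0, u₁]` a.e. on `[0, T]`. -/
def Admissible (T u₁ : ℝ) (u : ℝ → ℝ) : Prop :=
  Measurable u ∧ ∀ᵐ t ∂(volume.restrict (Set.Icc (0:ℝ) T)), u t ∈ Set.Icc (0:ℝ) u₁

/-- The state `(Ku)(t) = R₀ exp(−∫₀ᵗ u) + c ∫₀ᵗ exp(−∫ₛᵗ u) ds`. -/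
noncomputable def Kstate (R₀ c : ℝ) (u : ℝ → ℝ) (t : ℝ) : ℝ :=
  R₀ * Real.exp (-(∫ ξ in (0:ℝ)..t, u ξ)) +
    c * ∫ s in (0:ℝ)..t, Real.exp (-(∫ ξ in s..t, u ξ))

/-- The cost `J(u) = ∫₀ᵀ (α (Ku)(t) + β u(t)) dt`. -/
noncomputable def Jcost (α β c T R₀ : ℝ) (u : ℝ → ℝ) : ℝ :=
  ∫ t in (0:ℝ)..T, (α * Kstate R₀ c u t + β * u t)

theorem Admissible.intervalIntegrable {T u₁ : ℝ} {u : ℝ → ℝ} (hu : Admissible T u₁ u) {a b : ℝ}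
    (ha : a ∈ Set.Icc 0 T) (hb : b ∈ Set.Icc 0 T) : IntervalIntegrable u volume a b := by
  have hint : IntegrableOn u (Set.Icc 0 T) := by
    refine Integrable.of_bound hu.1.aestronglyMeasurable u₁ ?_
    filter_upwards [hu.2] with t ht
    rw [Real.norm_eq_abs, abs_of_nonneg ht.1]
    exact ht.2
  exact (hint.mono_set (Set.uIcc_subset_Icc ha hb)).intervalIntegrable

theorem Admissible.midpoint {T u₁ : ℝ} {u v : ℝ → ℝ} (hu : Admissible T u₁ u)
    (hv : Admissible T u₁ v) : Admissible T u₁ (fun t => (u t + v t) / 2) := by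
  refine ⟨(hu.1.add hv.1).div_const 2, ?_⟩
  filter_upwards [hu.2, hv.2] with t h₁ h₂
  exact ⟨by linarith [h₁.1, h₂.1], by linarith [h₁.2, h₂.2]⟩

theorem continuousOn_integral_left {T : ℝ} {u : ℝ → ℝ} (hT : 0 ≤ T)
    (hu : IntervalIntegrable u volume 0 T) :
    ContinuousOn (fun s => ∫ ξ in s..T, u ξ) (Set.Icc 0 T) := by
  have h := intervalIntegral.continuousOn_primitive_interval_left (μ := volume) (a := 0) (b := T)
    (f := u) (by rwa [Set.uIcc_of_le hT, ← intervalIntegrable_iff_integrableOn_Icc_of_le hT])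
  rwa [Set.uIcc_of_le hT] at h

theorem Kstate_eq_exp_mul {R₀ c T t : ℝ} {u : ℝ → ℝ} (hu : IntervalIntegrable u volume 0 T)
    (ht : t ∈ Set.Icc 0 T) :
    Kstate R₀ c u t = Real.exp (-(∫ ξ in (0:ℝ)..t, u ξ)) *
      (R₀ + c * ∫ s in (0:ℝ)..t, Real.exp (∫ ξ in (0:ℝ)..s, u ξ)) := by
  have hsub : ∀ r ∈ Set.Icc 0 T, IntervalIntegrable u volume 0 r := fun r hr =>
    hu.mono_set (by
      rw [Set.uIcc_of_le hr.1, Set.uIcc_of_le (hr.1.trans hr.2)]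
      exact Set.Icc_subset_Icc_right hr.2)
  have hI : ∫ s in (0:ℝ)..t, Real.exp (-(∫ ξ in s..t, u ξ)) =
      ∫ s in (0:ℝ)..t, Real.exp (-(∫ ξ in (0:ℝ)..t, u ξ)) * Real.exp (∫ ξ in (0:ℝ)..s, u ξ) := by
    refine intervalIntegral.integral_congr fun s hs => ?_
    rw [Set.uIcc_of_le ht.1] at hs
    rw [← Real.exp_add, ← intervalIntegral.integral_interval_sub_left (hsub t ht)
      (hsub s ⟨hs.1, hs.2.trans ht.2⟩)]
    ring_nf
  rw [Kstate, hI, intervalIntegral.integral_const_mul]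
  ring

theorem continuousOn_Kstate {R₀ c T : ℝ} {u : ℝ → ℝ} (hT : 0 ≤ T)
    (hu : IntervalIntegrable u volume 0 T) : ContinuousOn (Kstate R₀ c u) (Set.Icc 0 T) := by
  have primitive : ∀ f : ℝ → ℝ, IntervalIntegrable f volume 0 T →
      ContinuousOn (fun s => ∫ ξ in (0:ℝ)..s, f ξ) (Set.Icc 0 T) := fun f hf => by
    have h := intervalIntegral.continuousOn_primitive_interval' hf Set.left_mem_uIcc
    rwa [Set.uIcc_of_le hT] at h
  have hU := primitive u hu
  have hE := primitive _ (hU.rexp.intervalIntegrable_of_Icc hT)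
  exact (hU.neg.rexp.mul (continuousOn_const.add (continuousOn_const.mul hE))).congr
    fun t ht => Kstate_eq_exp_mul hu ht

theorem exp_neg_midpoint_gap (x y : ℝ) :
    Real.exp (-x) + Real.exp (-y) - 2 * Real.exp (-((x + y) / 2)) =
      (Real.exp (-x / 2) - Real.exp (-y / 2)) ^ 2 := by
  have hx : Real.exp (-x) = Real.exp (-x / 2) ^ 2 := by rw [← Real.exp_nat_mul]; ring_nf
  have hy : Real.exp (-y) = Real.exp (-y / 2) ^ 2 := by rw [← Real.exp_nat_mul]; ring_nf
  have hxy : Real.exp (-((x + y) / 2)) = Real.exp (-x / 2) * Real.exp (-y / 2) := by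
    rw [← Real.exp_add]; ring_nf
  rw [hx, hy, hxy]
  ring

/-- The convexity gap of the state map at the midpoint of two controls. -/
theorem Kstate_midpoint_gap {R₀ c t : ℝ} {u v : ℝ → ℝ} (ht : 0 ≤ t)
    (hu : IntervalIntegrable u volume 0 t) (hv : IntervalIntegrable v volume 0 t) :
    Kstate R₀ c u t + Kstate R₀ c v t - 2 * Kstate R₀ c (fun s => (u s + v s) / 2) t =
      R₀ * (Real.exp (-(∫ ξ in (0:ℝ)..t, u ξ) / 2) - Real.exp (-(∫ ξ in (0:ℝ)..t, v ξ) / 2)) ^ 2 +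
      c * ∫ s in (0:ℝ)..t,
        (Real.exp (-(∫ ξ in s..t, u ξ) / 2) - Real.exp (-(∫ ξ in s..t, v ξ) / 2)) ^ 2 := by
  have hmid : ∀ s ∈ Set.Icc 0 t, ∫ ξ in s..t, (u ξ + v ξ) / 2 =
      ((∫ ξ in s..t, u ξ) + ∫ ξ in s..t, v ξ) / 2 := fun s hs => by
    have hsub : Set.uIcc s t ⊆ Set.uIcc 0 t := by
      rw [Set.uIcc_of_le hs.2, Set.uIcc_of_le ht]
      exact Set.Icc_subset_Icc_left hs.1
    rw [intervalIntegral.integral_div,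
      intervalIntegral.integral_add (hu.mono_set hsub) (hv.mono_set hsub)]
  have hU := continuousOn_integral_left ht hu
  have hV := continuousOn_integral_left ht hv
  have hIu : IntervalIntegrable (fun s => Real.exp (-(∫ ξ in s..t, u ξ))) volume 0 t :=
    hU.neg.rexp.intervalIntegrable_of_Icc ht
  have hIv : IntervalIntegrable (fun s => Real.exp (-(∫ ξ in s..t, v ξ))) volume 0 t :=
    hV.neg.rexp.intervalIntegrable_of_Icc ht
  have hIw : IntervalIntegrable
      (fun s => 2 * Real.exp (-(((∫ ξ in s..t, u ξ) + ∫ ξ in s..t, v ξ) / 2))) volume 0 t :=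
    (((hU.add hV).div_const 2).neg.rexp.intervalIntegrable_of_Icc ht).const_mul 2
  have hw : ∫ s in (0:ℝ)..t, Real.exp (-(∫ ξ in s..t, (u ξ + v ξ) / 2)) =
      ∫ s in (0:ℝ)..t, Real.exp (-(((∫ ξ in s..t, u ξ) + ∫ ξ in s..t, v ξ) / 2)) := by
    refine intervalIntegral.integral_congr fun s hs => ?_
    rw [Set.uIcc_of_le ht] at hs
    simp only [hmid s hs]
  have hgap : ∫ s in (0:ℝ)..t,
        (Real.exp (-(∫ ξ in s..t, u ξ) / 2) - Real.exp (-(∫ ξ in s..t, v ξ) / 2)) ^ 2 =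
      (∫ s in (0:ℝ)..t, Real.exp (-(∫ ξ in s..t, u ξ))) +
      (∫ s in (0:ℝ)..t, Real.exp (-(∫ ξ in s..t, v ξ))) -
      2 * ∫ s in (0:ℝ)..t, Real.exp (-(((∫ ξ in s..t, u ξ) + ∫ ξ in s..t, v ξ) / 2)) := by
    rw [← intervalIntegral.integral_const_mul, ← intervalIntegral.integral_add hIu hIv,
      ← intervalIntegral.integral_sub (hIu.add hIv) hIw]
    exact intervalIntegral.integral_congr fun s _ => (exp_neg_midpoint_gap _ _).symm
  simp only [Kstate]
  rw [hw, hmid 0 ⟨le_rfl, ht⟩, hgap, ← exp_neg_midpoint_gap]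
  ring

theorem Kstate_midpoint_le {R₀ c t : ℝ} {u v : ℝ → ℝ} (hR₀ : 0 ≤ R₀) (hc : 0 ≤ c) (ht : 0 ≤ t)
    (hu : IntervalIntegrable u volume 0 t) (hv : IntervalIntegrable v volume 0 t) :
    0 ≤ Kstate R₀ c u t + Kstate R₀ c v t - 2 * Kstate R₀ c (fun s => (u s + v s) / 2) t := by
  rw [Kstate_midpoint_gap ht hu hv]
  have := intervalIntegral.integral_nonneg (μ := volume) ht fun s _ =>
    sq_nonneg (Real.exp (-(∫ ξ in s..t, u ξ) / 2) - Real.exp (-(∫ ξ in s..t, v ξ) / 2))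
  positivity

theorem eq_zero_of_intervalIntegral_nonpos {f : ℝ → ℝ} {a b : ℝ} (hab : a < b)
    (hf : ContinuousOn f (Set.Icc a b)) (hnn : ∀ x ∈ Set.Icc a b, 0 ≤ f x)
    (hint : ∫ x in a..b, f x ≤ 0) : ∀ x ∈ Set.Icc a b, f x = 0 := by
  intro x hx
  by_contra h
  exact absurd hint (not_le.2 (intervalIntegral.integral_pos hab hf
    (fun y hy => hnn y (Set.Ioc_subset_Icc_self hy)) ⟨x, hx, lt_of_le_of_ne (hnn x hx) (Ne.symm h)⟩))

/-- Equality in the midpoint convexity of the state at time `t` determines the control. -/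
theorem integral_eq_of_Kstate_midpoint_gap_eq_zero {R₀ c t : ℝ} {u v : ℝ → ℝ} (hR₀ : 0 ≤ R₀)
    (hc : 0 < c) (ht : 0 < t)
    (hu : IntervalIntegrable u volume 0 t) (hv : IntervalIntegrable v volume 0 t)
    (h : Kstate R₀ c u t + Kstate R₀ c v t - 2 * Kstate R₀ c (fun s => (u s + v s) / 2) t = 0) :
    ∀ s ∈ Set.Icc 0 t, ∫ ξ in s..t, u ξ = ∫ ξ in s..t, v ξ := by
  rw [Kstate_midpoint_gap ht.le hu hv] at h
  have hle : ∫ s in (0:ℝ)..t,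
      (Real.exp (-(∫ ξ in s..t, u ξ) / 2) - Real.exp (-(∫ ξ in s..t, v ξ) / 2)) ^ 2 ≤ 0 := by
    refine le_of_mul_le_mul_left ?_ hc
    rw [mul_zero]
    exact (le_add_of_nonneg_left (mul_nonneg hR₀ (sq_nonneg _))).trans h.le
  have hU := continuousOn_integral_left ht.le hu
  have hV := continuousOn_integral_left ht.le hv
  intro s hs
  have hz := eq_zero_of_intervalIntegral_nonpos ht
    (((hU.neg.div_const 2).rexp.sub (hV.neg.div_const 2).rexp).pow 2)
    (fun _ _ => sq_nonneg _) hle s hs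
  have := Real.exp_injective (sub_eq_zero.1 (pow_eq_zero_iff two_ne_zero |>.1 hz))
  simp only [Pi.neg_apply] at this
  linarith

theorem ae_eq_of_forall_integral_eq {T : ℝ} {u v : ℝ → ℝ} (hT : 0 ≤ T)
    (hu : IntervalIntegrable u volume 0 T) (hv : IntervalIntegrable v volume 0 T)
    (h : ∀ s ∈ Set.Icc 0 T, ∫ ξ in s..T, u ξ = ∫ ξ in s..T, v ξ) :
    ∀ᵐ t ∂(volume.restrict (Set.Icc 0 T)), u t = v t := by
  rw [← Measure.restrict_congr_set Ioo_ae_eq_Icc, ae_restrict_iff' measurableSet_Ioo]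
  filter_upwards [hu.ae_hasDerivAt_integral, hv.ae_hasDerivAt_integral] with x hxu hxv hx
  have hx' : x ∈ Set.uIcc 0 T := Set.uIcc_of_le hT ▸ Set.Ioo_subset_Icc_self hx
  refine (hxu hx' T Set.right_mem_uIcc).unique
    ((hxv hx' T Set.right_mem_uIcc).congr_of_eventuallyEq ?_)
  filter_upwards [Ioo_mem_nhds hx.1 hx.2] with y hy
  rw [intervalIntegral.integral_symm, h y (Set.Ioo_subset_Icc_self hy),
    ← intervalIntegral.integral_symm]

theorem Kstate_congr_ae {R₀ c T t : ℝ} {u v : ℝ → ℝ}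
    (h : ∀ᵐ t ∂(volume.restrict (Set.Icc 0 T)), u t = v t) (ht : t ∈ Set.Icc 0 T) :
    Kstate R₀ c u t = Kstate R₀ c v t := by
  have hint : ∀ s ∈ Set.Icc 0 t, ∫ ξ in s..t, u ξ = ∫ ξ in s..t, v ξ := fun s hs => by
    refine intervalIntegral.integral_congr_ae_restrict (ae_restrict_of_ae_restrict_of_subset ?_ h)
    rw [Set.uIoc_of_le hs.2]
    exact fun x hx => ⟨hs.1.trans hx.1.le, hx.2.trans ht.2⟩
  rw [Kstate, Kstate, hint 0 ⟨le_rfl, ht.1⟩]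
  congr 2
  refine intervalIntegral.integral_congr fun s hs => ?_
  rw [Set.uIcc_of_le ht.1] at hs
  simp only [hint s hs]

/-- uniqueness of the optimal solution; two optimal controls agree a.e.
on `[0,T]`, hence the optimal state trajectory is unique. -/
theorem optimal_control_unique (α β c u₁ T R₀ : ℝ)
    (hα : 0 < α) (hβ : 0 < β) (hc : 0 < c) (hu₁ : 0 < u₁) (hT : 0 < T)
    (hR₀ : 0 ≤ R₀)
    (uo ut : ℝ → ℝ) (huo : Admissible T u₁ uo) (hut : Admissible T u₁ ut)
    (hopt₁ : ∀ u : ℝ → ℝ, Admissible T u₁ u → Jcost α β c T R₀ uo ≤ Jcost α β c T R₀ u)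
    (hopt₂ : ∀ u : ℝ → ℝ, Admissible T u₁ u → Jcost α β c T R₀ ut ≤ Jcost α β c T R₀ u) :
    (∀ᵐ t ∂(volume.restrict (Set.Icc (0:ℝ) T)), uo t = ut t) ∧
    (∀ t ∈ Set.Icc (0:ℝ) T, Kstate R₀ c uo t = Kstate R₀ c ut t) := by
  have h0 : (0:ℝ) ∈ Set.Icc 0 T := ⟨le_rfl, hT.le⟩
  have hTT : T ∈ Set.Icc 0 T := ⟨hT.le, le_rfl⟩
  have hIo := huo.intervalIntegrable h0 hTT
  have hIt := hut.intervalIntegrable h0 hTT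
  have hw := huo.midpoint hut
  have hIw := hw.intervalIntegrable h0 hTT
  have hKo := continuousOn_Kstate (R₀ := R₀) (c := c) hT.le hIo
  have hKt := continuousOn_Kstate (R₀ := R₀) (c := c) hT.le hIt
  have hKw := continuousOn_Kstate (R₀ := R₀) (c := c) hT.le hIw
  have hcost : ∀ u : ℝ → ℝ, IntervalIntegrable u volume 0 T →
      ContinuousOn (Kstate R₀ c u) (Set.Icc 0 T) →
      Jcost α β c T R₀ u =
        α * (∫ t in (0:ℝ)..T, Kstate R₀ c u t) + β * ∫ t in (0:ℝ)..T, u t := fun u hu hK => by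
    rw [Jcost, intervalIntegral.integral_add
      ((hK.intervalIntegrable_of_Icc hT.le).const_mul α) (hu.const_mul β),
      intervalIntegral.integral_const_mul, intervalIntegral.integral_const_mul]
  have hgap : ∫ t in (0:ℝ)..T, (Kstate R₀ c uo t + Kstate R₀ c ut t -
      2 * Kstate R₀ c (fun s => (uo s + ut s) / 2) t) ≤ 0 := by
    have h₁ := hopt₁ _ hw
    have h₂ := hopt₂ _ hw
    rw [hcost _ hIw hKw, intervalIntegral.integral_div, intervalIntegral.integral_add hIo hIt]
      at h₁ h₂
    rw [hcost _ hIo hKo] at h₁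
    rw [hcost _ hIt hKt] at h₂
    have hIKo := hKo.intervalIntegrable_of_Icc (μ := volume) hT.le
    have hIKt := hKt.intervalIntegrable_of_Icc (μ := volume) hT.le
    rw [intervalIntegral.integral_sub (hIKo.add hIKt)
      ((hKw.intervalIntegrable_of_Icc hT.le).const_mul 2),
      intervalIntegral.integral_add hIKo hIKt, intervalIntegral.integral_const_mul]
    refine le_of_mul_le_mul_left ?_ hα
    linarith
  have hzero := eq_zero_of_intervalIntegral_nonpos hT
    ((hKo.add hKt).sub (continuousOn_const.mul hKw))
    (fun t ht => Kstate_midpoint_le hR₀ hc.le ht.1 (huo.intervalIntegrable h0 ht)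
      (hut.intervalIntegrable h0 ht)) hgap T hTT
  have hae := ae_eq_of_forall_integral_eq hT.le hIo hIt
    (integral_eq_of_Kstate_midpoint_gap_eq_zero hR₀ hc hT hIo hIt hzero)
  exact ⟨hae, fun t ht => Kstate_congr_ae hae ht⟩
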